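/- Suppose a bounded operator C on H = ℓ²(ℤ₊) ⊕ ℓ²(ℤ₊) has block form (X, Y; conj(Y), conj(X)) with XX* − YY* = I, X*X − Y*Y = I, XYᵗ = YXᵗ, and Y compact. Then there exist unitary operators U, V on ℓ²(ℤ₊) and a diagonal operator D with 0 ≤ D ≤ c for some c < 1 such that XV = U(I−D²)^{−1/2} and Y·conj(V) = UD(I−D²)^{−1/2}. -/

import Mathlib

open ContinuousLinearMap

/-- The Hilbert space `ℓ²(ℤ₊, ℂ)`. -/
noncomputable abbrev ellTwo : Type := lp (fun _ : ℕ => ℂ) 2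

theorem antilinear_invariant_orthogonal {H : Type*} [NormedAddCommGroup H] [InnerProductSpace ℂ H]
    (A : H →SL[starRingEnd ℂ] H) (hsym : ∀ f g : H, inner ℂ (A f) g = inner ℂ (A g) f)
    (K : Submodule ℂ H) (hK : ∀ f ∈ K, A f ∈ K) : ∀ f ∈ Kᗮ, A f ∈ Kᗮ := by
  intro f hf
  rw [Submodule.mem_orthogonal']
  intro u hu
  rw [hsym]
  exact (Submodule.mem_orthogonal _ _).1 hf _ (hK u hu)

/-- An antilinear symmetric compact operator has an eigenvector with non-negative eigenvalue in any
nonzero closed invariant complex subspace of the form `Kᗮ`. -/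
theorem antilinear_exists_eigenvector {H : Type*} [NormedAddCommGroup H] [InnerProductSpace ℂ H]
    [CompleteSpace H]
    (A : H →SL[starRingEnd ℂ] H) (hc : IsCompactOperator A)
    (hsym : ∀ f g : H, inner ℂ (A f) g = inner ℂ (A g) f)
    (K : Submodule ℂ H) (hK : ∀ f ∈ K, A f ∈ K) (hne : Kᗮ ≠ ⊥) :
    ∃ v ∈ Kᗮ, ‖v‖ = 1 ∧ ∃ d : ℝ, 0 ≤ d ∧ A v = (d : ℂ) • v := by
  let _ : InnerProductSpace ℝ H := InnerProductSpace.complexToReal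
  let T : H →L[ℝ] H :=
    { toFun := A
      map_add' := A.map_add
      map_smul' := by
        intro r x
        have := A.map_smulₛₗ (r : ℂ) x
        simpa using this
      cont := A.continuous }
  have hT : IsCompactOperator T := hc
  have hTs : (T : H →ₗ[ℝ] H).IsSymmetric := by
    intro x y
    change (inner ℂ (A x) y).re = (inner ℂ x (A y)).re
    rw [hsym, ← inner_conj_symm, Complex.conj_re]
  have hbot := ContinuousLinearMap.orthogonalComplement_iSup_eigenspaces_eq_bot hT hTs
  have hK1 : ∀ f ∈ Kᗮ, A f ∈ Kᗮ := antilinear_invariant_orthogonal A hsym K hK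
  have hK2 : ∀ f ∈ Kᗮᗮ, A f ∈ Kᗮᗮ := antilinear_invariant_orthogonal A hsym Kᗮ hK1
  -- some eigenvector is not in Kᗮᗮ
  obtain ⟨l, x, hx, hxK⟩ : ∃ (l : ℝ) (x : H), A x = (l : ℂ) • x ∧ x ∉ Kᗮᗮ := by
    by_contra! hcon
    obtain ⟨f, hf, hf0⟩ := Submodule.exists_mem_ne_zero_of_ne_bot hne
    apply hf0
    rw [← Submodule.mem_bot ℝ, ← hbot, Submodule.mem_orthogonal]
    intro u hu
    induction hu using Submodule.iSup_induction' with
    | mem l u hu =>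
      have h := hcon l u (by simpa [T] using Module.End.mem_eigenspace_iff.1 hu)
      change (inner ℂ u f).re = 0
      rw [(Submodule.mem_orthogonal' _ _).1 h f hf]; rfl
    | zero => simp
    | add a b _ _ ha hb => rw [inner_add_left, ha, hb, add_zero]
  obtain ⟨p, hp, q, hq, hpq⟩ := Submodule.exists_add_mem_mem_orthogonal (K := Kᗮ) x
  have hp0 : p ≠ 0 := by
    rintro rfl
    apply hxK
    simpa [hpq] using hq
  have hAp : A p = (l : ℂ) • p := by
    have e : A p - (l : ℂ) • p = (l : ℂ) • q - A q := by
      have : A p + A q = (l : ℂ) • p + (l : ℂ) • q := by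
        rw [← map_add, ← smul_add, ← hpq, hx]
      rw [sub_eq_sub_iff_add_eq_add, this, add_comm]
    have m1 : A p - (l : ℂ) • p ∈ Kᗮ := sub_mem (hK1 p hp) (Submodule.smul_mem _ _ hp)
    have m2 : A p - (l : ℂ) • p ∈ Kᗮᗮ := by
      rw [e]; exact sub_mem (Submodule.smul_mem _ _ hq) (hK2 q hq)
    have := (Submodule.mem_orthogonal _ _).1 m2 _ m1
    exact sub_eq_zero.1 (inner_self_eq_zero.1 this)
  -- sign
  obtain ⟨y, hy, hy0, d, hd, hAy⟩ : ∃ y ∈ Kᗮ, y ≠ 0 ∧ ∃ d : ℝ, 0 ≤ d ∧ A y = (d : ℂ) • y := by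
    rcases le_total 0 l with h | h
    · exact ⟨p, hp, hp0, l, h, hAp⟩
    · refine ⟨Complex.I • p, Submodule.smul_mem _ _ hp, by simp [hp0], -l, by linarith, ?_⟩
      rw [A.map_smulₛₗ, hAp, smul_smul, smul_smul]
      congr 1
      simp
      ring
  refine ⟨((‖y‖⁻¹ : ℝ) : ℂ) • y, Submodule.smul_mem _ _ hy, ?_, d, hd, ?_⟩
  · rw [norm_smul]; simp [hy0]
  · rw [A.map_smulₛₗ, hAy, smul_smul, smul_smul, Complex.conj_ofReal, mul_comm]

theorem antilinear_takagi {H : Type*} [NormedAddCommGroup H] [InnerProductSpace ℂ H]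
    [CompleteSpace H]
    (A : H →SL[starRingEnd ℂ] H) (hc : IsCompactOperator A)
    (hsym : ∀ f g : H, inner ℂ (A f) g = inner ℂ (A g) f) :
    ∃ s : Set H, Orthonormal ℂ (Subtype.val : s → H) ∧ (Submodule.span ℂ s)ᗮ = ⊥ ∧
      ∀ v ∈ s, ∃ d : ℝ, 0 ≤ d ∧ A v = (d : ℂ) • v := by
  obtain ⟨s, -, hs⟩ := zorn_subset_nonempty { b : Set H | Orthonormal ℂ (Subtype.val : b → H) ∧
      ∀ v ∈ b, ∃ d : ℝ, 0 ≤ d ∧ A v = (d : ℂ) • v } (by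
    refine fun c hc cc _c0 => ⟨⋃₀ c, ⟨?_, ?_⟩, ?_⟩
    · exact orthonormal_sUnion_of_directed cc.directedOn fun x xc => (hc xc).1
    · rintro v ⟨t, ht, hv⟩
      exact (hc ht).2 v hv
    · exact fun _ => Set.subset_sUnion_of_mem) ∅ ⟨orthonormal_empty ℂ H, by simp⟩
  refine ⟨s, hs.1.1, ?_, hs.1.2⟩
  by_contra hne
  obtain ⟨v, hv, hv1, hd⟩ := antilinear_exists_eigenvector A hc hsym (Submodule.span ℂ s) (by
    intro f hf
    induction hf using Submodule.span_induction with
    | mem x hx =>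
      obtain ⟨d, -, h⟩ := hs.1.2 x hx
      rw [h]
      exact Submodule.smul_mem _ _ (Submodule.subset_span hx)
    | zero => simp
    | add x y _ _ hx hy => rw [map_add]; exact add_mem hx hy
    | smul a x _ hx => rw [A.map_smulₛₗ]; exact Submodule.smul_mem _ _ hx) hne
  have hv' : ∀ u ∈ s, inner ℂ u v = 0 := fun u hu =>
    (Submodule.mem_orthogonal _ _).1 hv u (Submodule.subset_span hu)
  have hmem : v ∈ s := by
    refine hs.le_of_ge (y := insert v s) ⟨⟨?_, ?_⟩, ?_⟩ (Set.subset_insert _ _)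
      (Set.mem_insert _ _)
    · rintro ⟨x, rfl | hx⟩
      · exact hv1
      · exact hs.1.1.1 ⟨x, hx⟩
    · rintro ⟨x, rfl | hx⟩ ⟨y, rfl | hy⟩ hxy
      · exact absurd rfl hxy
      · exact inner_eq_zero_symm.1 (hv' y hy)
      · exact hv' x hx
      · exact hs.1.1.2 (i := ⟨x, hx⟩) (j := ⟨y, hy⟩) (fun h => hxy (Subtype.ext (Subtype.mk.inj h)))
    · rintro x (rfl | hx)
      · exact hd
      · exact hs.1.2 x hx
  have := hv' v hmem
  rw [inner_self_eq_zero] at this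
  simp [this] at hv1

theorem ellTwo_ext_inner {f : ellTwo} (h : ∀ n, inner ℂ f (lp.single 2 n (1 : ℂ)) = 0) : f = 0 := by
  ext n
  have := h n
  rw [lp.inner_single_right] at this
  simpa using this

theorem ellTwo_clm_ext {S T : ellTwo →L[ℂ] ellTwo}
    (h : ∀ n, S (lp.single 2 n (1 : ℂ)) = T (lp.single 2 n (1 : ℂ))) : S = T := by
  have key : adjoint S = adjoint T := by
    ext1 f
    rw [← sub_eq_zero]
    apply ellTwo_ext_inner
    intro n
    rw [inner_sub_left, adjoint_inner_left, adjoint_inner_left, h, sub_self]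
  have := congrArg adjoint key
  simpa using this

theorem ellTwo_orthonormal_single :
    Orthonormal ℂ (fun n : ℕ => (lp.single 2 n (1 : ℂ) : ellTwo)) := by
  constructor
  · intro n
    rw [lp.norm_single]
    · simp
    · norm_num
  · intro m n hmn
    rw [lp.inner_single_right]
    simp [hmn.symm, lp.single_apply]

theorem ellTwo_takagi (A : ellTwo →SL[starRingEnd ℂ] ellTwo) (hc : IsCompactOperator A)
    (hsym : ∀ f g : ellTwo, inner ℂ (A f) g = inner ℂ (A g) f) :
    ∃ (V : ellTwo →L[ℂ] ellTwo) (d : ℕ → ℝ), V ∈ unitary (ellTwo →L[ℂ] ellTwo) ∧ (∀ n, 0 ≤ d n) ∧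
      ∀ n : ℕ, A (V (lp.single 2 n (1 : ℂ))) = (d n : ℂ) • V (lp.single 2 n (1 : ℂ)) := by
  obtain ⟨s, hs, hspan, heig⟩ := antilinear_takagi A hc hsym
  have hcount : Countable s := by
    have hU : (Set.univ : Set s) ⊆
        ⋃ n : ℕ, Function.support (fun v : s => ‖inner ℂ (v : ellTwo) (lp.single 2 n (1:ℂ) : ellTwo)‖ ^ 2) := by
      intro v _
      by_contra hcon
      have hcon : ∀ n : ℕ, inner ℂ (v : ellTwo) (lp.single 2 n (1:ℂ) : ellTwo) = 0 := by
        simpa using hcon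
      exact hs.ne_zero v (ellTwo_ext_inner hcon)
    rw [← Set.countable_univ_iff]
    refine Set.Countable.mono hU (Set.countable_iUnion fun n => ?_)
    exact (hs.inner_products_summable _).countable_support
  have hinf : Infinite s := by
    by_contra hfin
    rw [not_infinite_iff_finite] at hfin
    have hsf : s.Finite := hfin
    have : FiniteDimensional ℂ (Submodule.span ℂ s) := FiniteDimensional.span_of_finite ℂ hsf
    have htop : Submodule.span ℂ s = ⊤ := by
      rwa [Submodule.orthogonal_eq_bot_iff] at hspan
    have : FiniteDimensional ℂ ellTwo := by
      rw [htop] at this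
      exact Module.Finite.of_surjective (Submodule.subtype (⊤ : Submodule ℂ ellTwo)) (fun x => ⟨⟨x, trivial⟩, rfl⟩)
    exact ellTwo_orthonormal_single.linearIndependent.finite.false
  obtain ⟨e⟩ : Nonempty (ℕ ≃ s) := by
    have := nonempty_denumerable_iff.2 ⟨hcount, hinf⟩
    obtain ⟨h⟩ := this
    exact ⟨(Denumerable.eqv s).symm⟩
  have hon : Orthonormal ℂ (fun n => (e n : ellTwo)) := hs.comp e e.injective
  let b : HilbertBasis ℕ ℂ ellTwo := HilbertBasis.mkOfOrthogonalEqBot hon (by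
    have : Set.range (fun n => (e n : ellTwo)) = s := by
      have := e.surjective.range_comp (Subtype.val : s → ellTwo)
      rw [Subtype.range_val] at this
      exact this
    rw [this]; exact hspan)
  have hb : ∀ n, b n = e n := fun n => by simp [b]
  let V := Unitary.linearIsometryEquiv.symm b.repr.symm
  have hV : ∀ n, (V : ellTwo →L[ℂ] ellTwo) (lp.single 2 n (1 : ℂ)) = e n := by
    intro n
    rw [← hb, ← b.repr_symm_single]
    rfl
  choose d hd hd' using fun n => heig (e n) (e n).2
  refine ⟨V, d, V.2, hd, fun n => ?_⟩
  rw [hV, hd']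

theorem block_isUnit {X Y : ellTwo →L[ℂ] ellTwo} (h1 : X * adjoint X - Y * adjoint Y = 1) 
    (h2 : adjoint X * X - adjoint Y * Y = 1) : IsUnit X := by
  have u1 : IsUnit (X * adjoint X) := by
    refine CStarAlgebra.isUnit_of_le 1 ?_
    rw [← sub_nonneg, ← h1, sub_sub_cancel]
    exact mul_star_self_nonneg Y
  have u2 : IsUnit (adjoint X * X) := by
    refine CStarAlgebra.isUnit_of_le 1 ?_
    rw [← sub_nonneg, ← h2, sub_sub_cancel]
    exact star_mul_self_nonneg Y
  obtain ⟨a, ha⟩ := u1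
  obtain ⟨b, hb⟩ := u2
  have r : X * (adjoint X * (a⁻¹ : (ellTwo →L[ℂ] ellTwo)ˣ)) = 1 := by
    rw [← mul_assoc, ← ha, Units.mul_inv]
  have l : ((b⁻¹ : (ellTwo →L[ℂ] ellTwo)ˣ) * adjoint X) * X = 1 := by
    rw [mul_assoc, ← hb, Units.inv_mul]
  exact isUnit_iff_exists_and_exists.2 ⟨⟨_, r⟩, ⟨_, l⟩⟩

theorem sqrt_part {A : Type*} [CStarAlgebra A] [PartialOrder A] [StarOrderedRing A]
   (D T : A) (h : T * star T = 1 - D * D) :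
   ∃ R : A, 0 ≤ R ∧ R * R = 1 - D * D ∧ R * D = D * R := by
  have hp : 0 ≤ 1 - D * D := h ▸ mul_star_self_nonneg T
  refine ⟨CFC.sqrt (1 - D * D), CFC.sqrt_nonneg _, CFC.sqrt_mul_sqrt_self _ hp, ?_⟩
  have hcm : Commute (1 - D * D) D := by
    change (1 - D * D) * D = D * (1 - D * D)
    noncomm_ring
  exact (hcm.cfcₙ_nnreal NNReal.sqrt)

theorem ell_mul_apply (S T : ellTwo →L[ℂ] ellTwo) (f : ellTwo) : (S * T) f = S (T f) := rfl

theorem ell_one_apply (f : ellTwo) : (1 : ellTwo →L[ℂ] ellTwo) f = f := rfl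

theorem conj_inner_swap (J : ellTwo → ellTwo)
    (hJ : ∀ (f : ellTwo) (n : ℕ), (J f : ∀ _ : ℕ, ℂ) n = (starRingEnd ℂ) ((f : ∀ _ : ℕ, ℂ) n))
    (f g : ellTwo) : inner ℂ (J f) (J g) = inner ℂ g f := by
  rw [lp.inner_eq_tsum, lp.inner_eq_tsum]
  congr 1
  ext n
  rw [hJ, hJ]
  simp [mul_comm]

theorem conj_exists_clm (J : ellTwo → ellTwo)
    (hJ : ∀ (f : ellTwo) (n : ℕ), (J f : ∀ _ : ℕ, ℂ) n = (starRingEnd ℂ) ((f : ∀ _ : ℕ, ℂ) n)) :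
    ∃ L : ellTwo →SL[starRingEnd ℂ] ellTwo, ∀ f, L f = J f := by
  let L : ellTwo →ₛₗ[starRingEnd ℂ] ellTwo :=
    { toFun := J
      map_add' := by
        intro f g
        ext n
        simp [hJ]
      map_smul' := by
        intro c f
        ext n
        simp [hJ] }
  refine ⟨L.mkContinuous 1 ?_, fun f => rfl⟩
  intro f
  rw [one_mul]
  apply le_of_eq
  change ‖J f‖ = ‖f‖
  rw [@norm_eq_sqrt_re_inner ℂ, @norm_eq_sqrt_re_inner ℂ, conj_inner_swap J hJ]

theorem conj_conj_apply (J : ellTwo → ellTwo)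
    (hJ : ∀ (f : ellTwo) (n : ℕ), (J f : ∀ _ : ℕ, ℂ) n = (starRingEnd ℂ) ((f : ∀ _ : ℕ, ℂ) n))
    (f : ellTwo) : J (J f) = f := by
  ext n
  simp [hJ]

theorem conj_single (J : ellTwo → ellTwo)
    (hJ : ∀ (f : ellTwo) (n : ℕ), (J f : ∀ _ : ℕ, ℂ) n = (starRingEnd ℂ) ((f : ∀ _ : ℕ, ℂ) n))
    (n : ℕ) : J (lp.single 2 n (1 : ℂ)) = lp.single 2 n (1 : ℂ) := by
  ext m
  rw [hJ, lp.single_apply, Pi.single_apply]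
  split_ifs <;> simp

theorem conj_adjoint (J : ellTwo → ellTwo)
    (hJ : ∀ (f : ellTwo) (n : ℕ), (J f : ∀ _ : ℕ, ℂ) n = (starRingEnd ℂ) ((f : ∀ _ : ℕ, ℂ) n))
    (T Tc : ellTwo →L[ℂ] ellTwo) (hTc : ∀ f, Tc f = J (T (J f))) (a : ellTwo) :
    adjoint Tc a = J (adjoint T (J a)) := by
  apply ext_inner_right ℂ
  intro b
  rw [adjoint_inner_left, hTc]
  have e1 := conj_inner_swap J hJ (J a) (T (J b))
  have e2 := conj_inner_swap J hJ (adjoint T (J a)) (J b)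
  rw [conj_conj_apply J hJ] at e1 e2
  rw [e1, e2, adjoint_inner_right]

set_option maxHeartbeats 2000000 in
/-- Takagi-type decomposition. -/
theorem takagi_decomposition_of_composition_blocks
    (J : ellTwo → ellTwo)
    (hJ : ∀ (f : ellTwo) (n : ℕ), (J f : ∀ _ : ℕ, ℂ) n = (starRingEnd ℂ) ((f : ∀ _ : ℕ, ℂ) n))
    (X Y Xc Yc : ellTwo →L[ℂ] ellTwo)
    (hXc : ∀ f, Xc f = J (X (J f))) (hYc : ∀ f, Yc f = J (Y (J f)))
    (h1 : X * adjoint X - Y * adjoint Y = 1)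
    (h2 : adjoint X * X - adjoint Y * Y = 1)
    (h3 : X * adjoint Yc = Y * adjoint Xc)
    (hYcompact : IsCompactOperator Y) :
    ∃ (U V Vc : ellTwo →L[ℂ] ellTwo) (d : ℕ → ℝ) (c : ℝ) (D R : ellTwo →L[ℂ] ellTwo),
      U ∈ unitary (ellTwo →L[ℂ] ellTwo) ∧
      V ∈ unitary (ellTwo →L[ℂ] ellTwo) ∧
      (∀ f, Vc f = J (V (J f))) ∧
      c < 1 ∧ (∀ n, 0 ≤ d n ∧ d n ≤ c) ∧
      (∀ n : ℕ, D (lp.single 2 n 1) = (d n : ℂ) • lp.single 2 n 1) ∧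
      R.IsPositive ∧ R * R = 1 - D * D ∧
      X * V * R = U ∧ Y * Vc * R = U * D := by
  obtain ⟨L, hL⟩ := conj_exists_clm J hJ
  have hJJ := conj_conj_apply J hJ
  obtain ⟨Xi, hXXi, hXiX⟩ := isUnit_iff_exists.1 (block_isUnit h1 h2)
  have hXsi : adjoint X * adjoint Xi = 1 := by
    have := congrArg star hXiX
    rwa [star_mul, star_one] at this
  have hXis : adjoint Xi * adjoint X = 1 := by
    have := congrArg star hXXi
    rwa [star_mul, star_one] at this
  set S := Xi * Y with hS
  have hXS : X * S = Y := by rw [hS, ← mul_assoc, hXXi, one_mul]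
  have hSX : S * adjoint Xc = adjoint Yc := by
    rw [hS, mul_assoc, ← h3, ← mul_assoc, hXiX, one_mul]
  let A : ellTwo →SL[starRingEnd ℂ] ellTwo := S.comp L
  have hA : ∀ f, A f = S (J f) := fun f => by simp [A, hL]
  have hAc : IsCompactOperator A := by
    have : IsCompactOperator S := hYcompact.clm_comp Xi
    exact this.comp_clm L
  have hAs : ∀ f g : ellTwo, inner ℂ (A f) g = inner ℂ (A g) f := by
    intro f g
    set b := adjoint Xi f with hb
    have hf : f = adjoint X b := by
      have := congrArg (fun T : ellTwo →L[ℂ] ellTwo => T f) hXsi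
      exact this.symm
    have e1 : A f = adjoint Yc (J b) := by
      rw [hA, ← hSX, ell_mul_apply S (adjoint Xc), conj_adjoint J hJ X Xc hXc, hJJ, ← hf]
    have e2 : inner ℂ (A g) f = inner ℂ (Y (J g)) b := by
      rw [hA, hf, adjoint_inner_right, ← ell_mul_apply, hXS]
    have e3 := conj_inner_swap J hJ b (Y (J g))
    rw [e1, e2, adjoint_inner_left, hYc, e3]
  obtain ⟨V, d, hV, hd, hAV⟩ := ellTwo_takagi A hAc hAs
  have hV1 : adjoint V * V = 1 := (Unitary.mem_iff.1 hV).1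
  have hV2 : V * adjoint V = 1 := (Unitary.mem_iff.1 hV).2
  let Vc : ellTwo →L[ℂ] ellTwo := L.comp (V.comp L)
  have hVc : ∀ f, Vc f = J (V (J f)) := fun f => by simp [Vc, hL]
  have hVcs : Vc * adjoint Vc = 1 := by
    ext1 f
    rw [ell_mul_apply, conj_adjoint J hJ V Vc hVc, hVc, hJJ, ← ell_mul_apply V, hV2, ell_one_apply, hJJ,
      ell_one_apply]
  set D := adjoint V * S * Vc with hD
  have hDe : ∀ n : ℕ, D (lp.single 2 n 1) = (d n : ℂ) • lp.single 2 n 1 := by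
    intro n
    rw [hD, ell_mul_apply, ell_mul_apply, hVc, conj_single J hJ, ← hA, hAV, map_smul, ← ell_mul_apply, hV1,
      ell_one_apply]
  have hDs : adjoint D = D := by
    apply ellTwo_clm_ext
    intro n
    rw [← sub_eq_zero]
    apply ellTwo_ext_inner
    intro m
    rw [inner_sub_left, adjoint_inner_left, hDe, hDe, inner_smul_left, inner_smul_right]
    rcases eq_or_ne n m with rfl | h
    · simp
    · have := ellTwo_orthonormal_single.2 h
      simp only at this
      rw [this]; simp
  have hVD : V * D = S * Vc := by
    rw [hD, ← mul_assoc, ← mul_assoc, hV2, one_mul]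
  have hSS : 1 - S * adjoint S = Xi * adjoint Xi := by
    have hYY : Y * adjoint Y = X * adjoint X - 1 := by rw [← h1, sub_sub_cancel]
    have : S * adjoint S = Xi * (Y * adjoint Y) * adjoint Xi := by
      rw [hS, ← star_eq_adjoint, star_mul, star_eq_adjoint, star_eq_adjoint]
      noncomm_ring
    rw [this, hYY]
    have : Xi * (X * adjoint X - 1) * adjoint Xi
        = (Xi * X) * (adjoint X * adjoint Xi) - Xi * adjoint Xi := by noncomm_ring
    rw [this, hXiX, hXsi]
    simp
  have hDD : D * D = adjoint V * (S * adjoint S) * V := by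
    have e : adjoint D = adjoint Vc * adjoint S * V := by
      rw [hD]
      simp only [← star_eq_adjoint, star_mul, star_star, mul_assoc]
    calc D * D = D * adjoint D := by rw [hDs]
      _ = adjoint V * S * (Vc * adjoint Vc) * adjoint S * V := by rw [e, hD]; noncomm_ring
      _ = _ := by rw [hVcs]; noncomm_ring
  set T := adjoint V * Xi with hT
  have hTs : star T = adjoint Xi * V := by
    rw [hT, star_mul, ← star_eq_adjoint, star_star, star_eq_adjoint]
  have hTT : T * star T = 1 - D * D := by
    rw [hDD, hTs, hT]
    have : adjoint V * Xi * (adjoint Xi * V) = adjoint V * (Xi * adjoint Xi) * V := by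
      noncomm_ring
    rw [this, ← hSS, mul_sub, sub_mul, mul_one, hV1]
  obtain ⟨R, hR0, hRR, hRD⟩ := sqrt_part D T hTT
  have hRs : star R = R := (IsSelfAdjoint.of_nonneg hR0).star_eq
  set M : ℝ := ‖adjoint V * adjoint X‖ ^ 2 + 1 with hM
  have hMpos : 0 < M := by positivity
  have hbound : ∀ n, 1 ≤ M * (1 - d n ^ 2) := by
    intro n
    set e : ellTwo := lp.single 2 n (1 : ℂ) with he
    have hne : ‖e‖ = 1 := ellTwo_orthonormal_single.1 n
    have k1 : ‖star T e‖ ^ 2 = 1 - d n ^ 2 := by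
      have a1 : (inner ℂ (star T e) (star T e) : ℂ) = inner ℂ e ((1 - D * D) e) := by
        rw [← hTT, ell_mul_apply]
        nth_rewrite 1 [star_eq_adjoint]
        rw [adjoint_inner_left]
      have a2 : (1 - D * D) e = ((1 - d n ^ 2 : ℝ) : ℂ) • e := by
        rw [sub_apply, ell_mul_apply, ell_one_apply, hDe, map_smul, hDe, smul_smul]
        push_cast
        rw [sub_smul, one_smul, pow_two]
      rw [a2, inner_smul_right, inner_self_eq_norm_sq_to_K, inner_self_eq_norm_sq_to_K, hne] at a1
      have a3 : ((‖star T e‖ ^ 2 : ℝ) : ℂ) = ((1 - d n ^ 2 : ℝ) : ℂ) := by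
        simpa using a1
      exact_mod_cast a3
    have k2 : (adjoint V * adjoint X) (star T e) = e := by
      rw [← ell_mul_apply, hTs]
      have : adjoint V * adjoint X * (adjoint Xi * V)
        = adjoint V * (adjoint X * adjoint Xi) * V := by noncomm_ring
      rw [this, hXsi, mul_one, hV1, ell_one_apply]
    have k3 := (adjoint V * adjoint X).le_opNorm (star T e)
    rw [k2, hne] at k3
    have k4 : 1 ≤ (‖adjoint V * adjoint X‖ * ‖star T e‖) ^ 2 := one_le_pow₀ k3
    rw [mul_pow, k1] at k4
    have k5 : 0 ≤ 1 - d n ^ 2 := by rw [← k1]; positivity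
    rw [hM]
    linarith
  refine ⟨X * V * R, V, Vc, d, Real.sqrt (1 - 1 / M), D, R, ?_, hV, hVc, ?_, ?_, hDe, ?_, hRR, rfl,
    ?_⟩
  · rw [Unitary.mem_iff]
    have hst : star (X * V * R) = R * adjoint V * adjoint X := by
      rw [star_mul, star_mul, hRs, star_eq_adjoint, star_eq_adjoint, mul_assoc]
    have hRR' : R * R = adjoint V * Xi * (adjoint Xi * V) := by rw [hRR, ← hTT, hTs]
    rw [hst]
    set G := adjoint V * adjoint X * (X * V) with hG
    have g1 : R * R * G = 1 := by
      calc R * R * G = adjoint V * Xi * adjoint Xi * (V * adjoint V) * adjoint X * (X * V) := by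
            rw [hRR', hG]; noncomm_ring
        _ = adjoint V * Xi * (adjoint Xi * adjoint X) * (X * V) := by rw [hV2]; noncomm_ring
        _ = adjoint V * (Xi * X) * V := by rw [hXis]; noncomm_ring
        _ = 1 := by rw [hXiX, mul_one, hV1]
    have g2 : G * (R * R) = 1 := by
      calc G * (R * R) = adjoint V * adjoint X * X * (V * adjoint V) * Xi * (adjoint Xi * V) := by
            rw [hRR', hG]; noncomm_ring
        _ = adjoint V * adjoint X * (X * Xi) * (adjoint Xi * V) := by rw [hV2]; noncomm_ring
        _ = adjoint V * (adjoint X * adjoint Xi) * V := by rw [hXXi]; noncomm_ring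
        _ = 1 := by rw [hXsi, mul_one, hV1]
    constructor
    · calc R * adjoint V * adjoint X * (X * V * R) = R * G * R := by rw [hG]; noncomm_ring
        _ = R * G * R * (R * R * G) := by rw [g1, mul_one]
        _ = R * (G * (R * R)) * R * G := by noncomm_ring
        _ = R * R * G := by rw [g2, mul_one]
        _ = 1 := g1
    · calc X * V * R * (R * adjoint V * adjoint X) = X * V * (R * R) * adjoint V * adjoint X := by
            noncomm_ring
        _ = X * (V * adjoint V) * Xi * adjoint Xi * (V * adjoint V) * adjoint X := by
            rw [hRR']; noncomm_ring
        _ = (X * Xi) * (adjoint Xi * adjoint X) := by rw [hV2]; noncomm_ring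
        _ = 1 := by rw [hXXi, hXis, mul_one]
  · rw [Real.sqrt_lt' one_pos]
    have : 0 < 1 / M := by positivity
    linarith
  · intro n
    refine ⟨hd n, Real.le_sqrt_of_sq_le ?_⟩
    have := hbound n
    have : 1 / M ≤ 1 - d n ^ 2 := by
      rw [div_le_iff₀ hMpos]; linarith
    linarith
  · exact (nonneg_iff_isPositive R).1 hR0
  · calc Y * Vc * R = X * (S * Vc) * R := by rw [← hXS]; noncomm_ring
      _ = X * V * (D * R) := by rw [← hVD]; noncomm_ring
      _ = X * V * R * D := by rw [← hRD]; noncomm_ring
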